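/- Fix k, l ∈ ℝ^d, and for each n ≥ 1 let p_n be the n-th Taylor coefficient at z = 0 of the function z ↦ Λ_z((k+l)n^{−1/4}) Λ_z(k n^{−1/4}) Λ_z(l n^{−1/4}) (analytic on the open unit disk). Then lim_{n→∞} 4√(8π) n^{−1/2} p_n = Â⁽³⁾(k,l). -/

import Mathlib

open MeasureTheory Set

noncomputable section

/-- `Λ_z(k) = 1/(|k|² + 2^{3/2}√(1-z))` as a function of the complex variable `z`,
where `a` stands for `|k|²`.  Here `(1-z)^{1/2}` is the principal branch, which has
branch cut `z ∈ [1,∞)` and is positive for real `z < 1`, and `2^{3/2} = 2√2`. -/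
def LambdaC (a : ℝ) (z : ℂ) : ℂ :=
  1 / ((a : ℂ) + ((2 * Real.sqrt 2 : ℝ) : ℂ) * (1 - z) ^ ((1 : ℂ) / 2))

/-- `Λ_z(k)` for `k ∈ ℝ^d`. -/
def Lambda {d : ℕ} (k : Fin d → ℝ) (z : ℂ) : ℂ := LambdaC (∑ i, (k i) ^ 2) z

/-- The `n`-th Taylor coefficient at `z = 0` of an analytic function `f : ℂ → ℂ`. -/
def taylorCoeff (f : ℂ → ℂ) (n : ℕ) : ℂ := iteratedDeriv n f 0 / n.factorial

/-- `Â⁽³⁾(k,l)`, the Fourier transform of the ISE mean joint mass density. -/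
def AhatThree {d : ℕ} (k l : Fin d → ℝ) : ℝ :=
  ∫ t₁ in Ioi (0 : ℝ), ∫ t₂ in Ioi (0 : ℝ), ∫ t₃ in Ioi (0 : ℝ),
    (t₁ + t₂ + t₃) * Real.exp (-(t₁ + t₂ + t₃) ^ 2 / 2) *
      Real.exp (-((∑ i, (k i + l i) ^ 2) * t₁ + (∑ i, (k i) ^ 2) * t₂ +
        (∑ i, (l i) ^ 2) * t₃) / 2)

open Filter Topology

/-- The density at `τ` of the first hitting time of level `x` by a Brownian motion of variance `2`
per unit time (a Lévy distribution). -/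
def levyDensity (x τ : ℝ) : ℝ :=
  x / (2 * √Real.pi * (τ * √τ)) * Real.exp (-x ^ 2 / (4 * τ))

/-- The unnormalised error function. -/
def gaussianPrimitive (u : ℝ) : ℝ := ∫ y in (0 : ℝ)..u, Real.exp (-y ^ 2)

lemma hasDerivAt_gaussianPrimitive (u : ℝ) :
    HasDerivAt gaussianPrimitive (Real.exp (-u ^ 2)) u := by
  have hc : Continuous fun y : ℝ => Real.exp (-y ^ 2) := by fun_prop
  exact intervalIntegral.integral_hasDerivAt_right (hc.intervalIntegrable _ _)
    (hc.stronglyMeasurableAtFilter _ _) hc.continuousAt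

lemma tendsto_gaussianPrimitive_atTop :
    Tendsto gaussianPrimitive atTop (𝓝 (√Real.pi / 2)) := by
  have h := intervalIntegral_tendsto_integral_Ioi (f := fun y : ℝ => Real.exp (-1 * y ^ 2))
    (μ := volume) 0 (integrable_exp_neg_mul_sq one_pos).integrableOn tendsto_id
  rw [integral_gaussian_Ioi 1] at h
  simpa [gaussianPrimitive, Function.id_def] using! h

lemma gaussianPrimitive_neg (u : ℝ) : gaussianPrimitive (-u) = -gaussianPrimitive u := by
  have h := intervalIntegral.integral_comp_neg (a := 0) (b := u)
    (fun y : ℝ => Real.exp (-y ^ 2))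
  simp only [neg_sq, neg_zero] at h
  rw [gaussianPrimitive, gaussianPrimitive, h, ← intervalIntegral.integral_symm]

lemma tendsto_gaussianPrimitive_atBot :
    Tendsto gaussianPrimitive atBot (𝓝 (-(√Real.pi / 2))) := by
  have h := (tendsto_gaussianPrimitive_atTop.comp tendsto_neg_atBot_atTop).neg
  simpa [Function.comp_def, gaussianPrimitive_neg] using h

lemma tendsto_sqrt_nhdsGT_zero : Tendsto (fun τ : ℝ => √τ) (𝓝[>] 0) (𝓝[>] 0) := by
  refine tendsto_nhdsWithin_iff.2 ⟨?_, ?_⟩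
  · have := (Real.continuous_sqrt.tendsto 0).mono_left (nhdsWithin_le_nhds (s := Ioi 0))
    simpa using this
  · filter_upwards [self_mem_nhdsWithin] with τ hτ
    exact Real.sqrt_pos.2 hτ

/-- An antiderivative of `τ ↦ levyDensity x τ * exp (-s² τ)`. -/
def levyPrimitive (x s τ : ℝ) : ℝ :=
  (Real.exp (-(x * s)) * gaussianPrimitive (s * √τ - x / (2 * √τ)) -
    Real.exp (x * s) * gaussianPrimitive (s * √τ + x / (2 * √τ))) / √Real.pi

lemma hasDerivAt_levyPrimitive (x s : ℝ) {τ : ℝ} (hτ : 0 < τ) :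
    HasDerivAt (levyPrimitive x s) (levyDensity x τ * Real.exp (-(s ^ 2 * τ))) τ := by
  have hr : 0 < √τ := Real.sqrt_pos.2 hτ
  have hsq : √τ ^ 2 = τ := Real.sq_sqrt hτ.le
  have hd : HasDerivAt (fun τ : ℝ => √τ) (1 / (2 * √τ)) τ := Real.hasDerivAt_sqrt hτ.ne'
  have hi : HasDerivAt (fun τ : ℝ => x / (2 * √τ)) (-(x * (1 / (2 * √τ))) / (2 * √τ ^ 2)) τ := by
    have h := ((hasDerivAt_const τ x).div (hd.const_mul 2) (by positivity))
    convert! h using 1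
    field_simp
    ring
  have hu := (hasDerivAt_gaussianPrimitive (s * √τ - x / (2 * √τ))).comp τ
    ((hd.const_mul s).sub hi)
  have hv := (hasDerivAt_gaussianPrimitive (s * √τ + x / (2 * √τ))).comp τ
    ((hd.const_mul s).add hi)
  have h := ((hu.const_mul (Real.exp (-(x * s)))).sub
    (hv.const_mul (Real.exp (x * s)))).div_const (√Real.pi)
  convert! h using 1
  have e1 : Real.exp (-(x * s)) * Real.exp (-(s * √τ - x / (2 * √τ)) ^ 2) =
      Real.exp (-x ^ 2 / (4 * τ)) * Real.exp (-(s ^ 2 * τ)) := by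
    rw [← Real.exp_add, ← Real.exp_add]
    congr 1
    rw [show -x ^ 2 / (4 * τ) = -x ^ 2 / (4 * √τ ^ 2) by rw [hsq],
      show s ^ 2 * τ = s ^ 2 * √τ ^ 2 by rw [hsq]]
    field_simp
    ring
  have e2 : Real.exp (x * s) * Real.exp (-(s * √τ + x / (2 * √τ)) ^ 2) =
      Real.exp (-x ^ 2 / (4 * τ)) * Real.exp (-(s ^ 2 * τ)) := by
    rw [← Real.exp_add, ← Real.exp_add]
    congr 1
    rw [show -x ^ 2 / (4 * τ) = -x ^ 2 / (4 * √τ ^ 2) by rw [hsq],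
      show s ^ 2 * τ = s ^ 2 * √τ ^ 2 by rw [hsq]]
    field_simp
    ring
  rw [← mul_assoc, ← mul_assoc, e1, e2, levyDensity]
  have : τ * √τ = √τ ^ 3 := by rw [pow_succ, hsq]
  rw [this]
  have hpi : 0 < √Real.pi := Real.sqrt_pos.2 Real.pi_pos
  field_simp
  ring

lemma tendsto_levyPrimitive_zero {x : ℝ} (s : ℝ) (hx : 0 < x) :
    Tendsto (levyPrimitive x s) (𝓝[>] 0)
      (𝓝 (-(Real.exp (-(x * s)) + Real.exp (x * s)) / 2)) := by
  have h1 : Tendsto (fun τ : ℝ => s * √τ) (𝓝[>] 0) (𝓝 0) := by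
    have := (tendsto_nhds_of_tendsto_nhdsWithin tendsto_sqrt_nhdsGT_zero).const_mul s
    simpa using this
  have h2 : Tendsto (fun τ : ℝ => x / (2 * √τ)) (𝓝[>] 0) atTop := by
    have := (tendsto_inv_nhdsGT_zero.comp tendsto_sqrt_nhdsGT_zero).const_mul_atTop
      (half_pos hx)
    refine this.congr fun τ => ?_
    simp only [Function.comp]
    ring
  have hu : Tendsto (fun τ : ℝ => s * √τ - x / (2 * √τ)) (𝓝[>] 0) atBot := by
    simpa [sub_eq_add_neg] using h1.add_atBot (tendsto_neg_atTop_atBot.comp h2)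
  have hv : Tendsto (fun τ : ℝ => s * √τ + x / (2 * √τ)) (𝓝[>] 0) atTop := h1.add_atTop h2
  have h := (((tendsto_gaussianPrimitive_atBot.comp hu).const_mul (Real.exp (-(x * s)))).sub
    ((tendsto_gaussianPrimitive_atTop.comp hv).const_mul (Real.exp (x * s)))).div_const (√Real.pi)
  convert! h using 2
  have hpi : 0 < √Real.pi := Real.sqrt_pos.2 Real.pi_pos
  field_simp
  ring

lemma tendsto_levyPrimitive_atTop (x : ℝ) {s : ℝ} (hs : 0 < s) :
    Tendsto (levyPrimitive x s) atTop
      (𝓝 ((Real.exp (-(x * s)) - Real.exp (x * s)) / 2)) := by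
  have h1 : Tendsto (fun τ : ℝ => s * √τ) atTop atTop :=
    Real.tendsto_sqrt_atTop.const_mul_atTop hs
  have h2 : Tendsto (fun τ : ℝ => x / (2 * √τ)) atTop (𝓝 0) :=
    (Real.tendsto_sqrt_atTop.const_mul_atTop two_pos).const_div_atTop x
  have hu : Tendsto (fun τ : ℝ => s * √τ - x / (2 * √τ)) atTop atTop := by
    simpa [sub_eq_add_neg] using h1.atTop_add h2.neg
  have hv : Tendsto (fun τ : ℝ => s * √τ + x / (2 * √τ)) atTop atTop := h1.atTop_add h2
  have h := (((tendsto_gaussianPrimitive_atTop.comp hu).const_mul (Real.exp (-(x * s)))).sub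
    ((tendsto_gaussianPrimitive_atTop.comp hv).const_mul (Real.exp (x * s)))).div_const (√Real.pi)
  convert! h using 2
  have hpi : 0 < √Real.pi := Real.sqrt_pos.2 Real.pi_pos
  field_simp

lemma levyDensity_nonneg {x τ : ℝ} (hx : 0 ≤ x) (hτ : 0 ≤ τ) : 0 ≤ levyDensity x τ := by
  unfold levyDensity
  positivity

/-- The Laplace transform of the Lévy density. -/
lemma laplace_levyDensity {x s : ℝ} (hx : 0 < x) (hs : 0 < s) :
    IntegrableOn (fun τ => levyDensity x τ * Real.exp (-(s ^ 2 * τ))) (Ioi 0) ∧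
      ∫ τ in Ioi 0, levyDensity x τ * Real.exp (-(s ^ 2 * τ)) = Real.exp (-(x * s)) := by
  classical
  set L := -(Real.exp (-(x * s)) + Real.exp (x * s)) / 2 with hL
  set g := Function.update (levyPrimitive x s) 0 L with hg
  have hne : ∀ {τ : ℝ}, τ ≠ 0 → g =ᶠ[𝓝 τ] levyPrimitive x s := fun {τ} hτ => by
    filter_upwards [isOpen_ne.mem_nhds hτ] with y hy
    exact Function.update_of_ne hy _ _
  have hcont : ContinuousWithinAt g (Ici 0) 0 := by
    have hIoi : Ici (0 : ℝ) \ {0} = Ioi 0 := by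
      ext y
      simp [lt_iff_le_and_ne, eq_comm]
    rw [hg, continuousWithinAt_update_same, hIoi]
    exact tendsto_levyPrimitive_zero s hx
  have hderiv : ∀ τ ∈ Ioi (0 : ℝ),
      HasDerivAt g (levyDensity x τ * Real.exp (-(s ^ 2 * τ))) τ := fun τ hτ =>
    (hasDerivAt_levyPrimitive x s hτ).congr_of_eventuallyEq (hne (ne_of_gt hτ))
  have hpos : ∀ τ ∈ Ioi (0 : ℝ), 0 ≤ levyDensity x τ * Real.exp (-(s ^ 2 * τ)) := fun τ hτ =>
    mul_nonneg (levyDensity_nonneg hx.le (le_of_lt hτ)) (Real.exp_pos _).le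
  have htop : Tendsto g atTop (𝓝 ((Real.exp (-(x * s)) - Real.exp (x * s)) / 2)) :=
    (tendsto_levyPrimitive_atTop x hs).congr' <| by
      filter_upwards [eventually_ne_atTop 0] with y hy
      exact (Function.update_of_ne hy _ _).symm
  refine ⟨integrableOn_Ioi_deriv_of_nonneg hcont hderiv hpos htop, ?_⟩
  rw [integral_Ioi_of_hasDerivAt_of_nonneg hcont hderiv hpos htop, hg, Function.update_self, hL]
  ring

/-- The open positive octant. -/
def octant : Set (ℝ × ℝ × ℝ) := Ioi 0 ×ˢ (Ioi 0 ×ˢ Ioi 0)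

lemma measurableSet_octant : MeasurableSet octant :=
  measurableSet_Ioi.prod (measurableSet_Ioi.prod measurableSet_Ioi)

lemma mem_octant {u : ℝ × ℝ × ℝ} : u ∈ octant ↔ 0 < u.1 ∧ 0 < u.2.1 ∧ 0 < u.2.2 := Iff.rfl

lemma volume_restrict_octant :
    (volume : Measure (ℝ × ℝ × ℝ)).restrict octant =
      (volume.restrict (Ioi 0)).prod ((volume.restrict (Ioi 0)).prod (volume.restrict (Ioi 0))) := by
  rw [octant, Measure.prod_restrict, Measure.prod_restrict]
  rfl

open Pointwise in
lemma smul_octant {R : ℝ} (hR : 0 < R) : R • octant = octant := by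
  ext u
  rw [mem_smul_set_iff_inv_smul_mem₀ hR.ne', mem_octant, mem_octant]
  simp [hR]

lemma setIntegral_octant_comp_smul (f : ℝ × ℝ × ℝ → ℝ) {R : ℝ} (hR : 0 < R) :
    ∫ u in octant, f (R • u) = (R ^ 3)⁻¹ * ∫ u in octant, f u := by
  have : (volume : Measure (ℝ × ℝ)).IsAddHaarMeasure :=
    Measure.prod.instIsAddHaarMeasure volume volume
  have : (volume : Measure (ℝ × ℝ × ℝ)).IsAddHaarMeasure :=
    Measure.prod.instIsAddHaarMeasure volume volume
  have h := Measure.setIntegral_comp_smul_of_pos (volume : Measure (ℝ × ℝ × ℝ)) f octant hR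
  rw [smul_octant hR] at h
  simpa using! h

lemma integrableOn_exp_neg_octant {p q r : ℝ} (hp : 0 < p) (hq : 0 < q) (hr : 0 < r) :
    IntegrableOn (fun u : ℝ × ℝ × ℝ => Real.exp (-(p * u.1 + q * u.2.1 + r * u.2.2))) octant := by
  rw [IntegrableOn, volume_restrict_octant]
  have h := (exp_neg_integrableOn_Ioi 0 hp).mul_prod
    ((exp_neg_integrableOn_Ioi 0 hq).mul_prod (exp_neg_integrableOn_Ioi 0 hr))
  refine h.congr (Eventually.of_forall fun u => ?_)
  simp only [← Real.exp_add]
  congr 1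
  ring

lemma setIntegral_exp_neg_octant {p q r : ℝ} (hp : 0 < p) (hq : 0 < q) (hr : 0 < r) :
    ∫ u in octant, Real.exp (-(p * u.1 + q * u.2.1 + r * u.2.2)) = (p * q * r)⁻¹ := by
  have h1 : ∀ {b : ℝ}, 0 < b → ∫ t in Ioi (0 : ℝ), Real.exp (-b * t) = b⁻¹ := fun {b} hb => by
    rw [integral_exp_mul_Ioi (neg_lt_zero.2 hb) 0]
    simp
  have h : ∀ u : ℝ × ℝ × ℝ, Real.exp (-(p * u.1 + q * u.2.1 + r * u.2.2)) =
      Real.exp (-p * u.1) * (fun v : ℝ × ℝ => Real.exp (-q * v.1) * Real.exp (-r * v.2)) u.2 := by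
    intro u
    simp only [← Real.exp_add]
    congr 1
    ring
  simp_rw [h]
  rw [volume_restrict_octant, integral_prod_mul (fun t => Real.exp (-p * t))
    (fun v : ℝ × ℝ => Real.exp (-q * v.1) * Real.exp (-r * v.2)),
    integral_prod_mul (fun t => Real.exp (-q * t)) (fun t => Real.exp (-r * t)),
    h1 hp, h1 hq, h1 hr]
  simp only [mul_inv, mul_assoc]

/-- The integrand of the Fourier transform of the ISE mean joint mass density, with the squared
frequencies `a`, `b`, `e` scaled by `r`. -/
def iseKernel (a b e r : ℝ) (u : ℝ × ℝ × ℝ) : ℝ :=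
  (u.1 + u.2.1 + u.2.2) * Real.exp (-(u.1 + u.2.1 + u.2.2) ^ 2 / 2) *
    Real.exp (-(r * (a * u.1 + b * u.2.1 + e * u.2.2)) / 2)

/-- The integral of `iseKernel` over the octant. -/
def iseTransform (a b e r : ℝ) : ℝ := ∫ u in octant, iseKernel a b e r u

lemma continuous_iseKernel (a b e r : ℝ) : Continuous (iseKernel a b e r) := by
  unfold iseKernel
  fun_prop

lemma iseKernel_nonneg (a b e r : ℝ) {u : ℝ × ℝ × ℝ} (hu : u ∈ octant) :
    0 ≤ iseKernel a b e r u := by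
  obtain ⟨h1, h2, h3⟩ := mem_octant.1 hu
  unfold iseKernel
  positivity

section Kernel

variable {a b e : ℝ}

lemma iseKernel_le_zero (ha : 0 ≤ a) (hb : 0 ≤ b) (he : 0 ≤ e) {r : ℝ} (hr : 0 ≤ r)
    {u : ℝ × ℝ × ℝ} (hu : u ∈ octant) : iseKernel a b e r u ≤ iseKernel a b e 0 u := by
  obtain ⟨h1, h2, h3⟩ := mem_octant.1 hu
  unfold iseKernel
  gcongr

lemma integrableOn_iseKernel (ha : 0 ≤ a) (hb : 0 ≤ b) (he : 0 ≤ e) {r : ℝ} (hr : 0 ≤ r) :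
    IntegrableOn (iseKernel a b e r) octant := by
  have h := (integrableOn_exp_neg_octant one_pos one_pos one_pos).const_mul (Real.exp 2)
  refine Integrable.mono' h (continuous_iseKernel a b e r).aestronglyMeasurable ?_
  filter_upwards [ae_restrict_mem measurableSet_octant] with u hu
  rw [Real.norm_of_nonneg (iseKernel_nonneg a b e r hu)]
  refine (iseKernel_le_zero ha hb he hr hu).trans ?_
  unfold iseKernel
  simp only [zero_mul, neg_zero, zero_div, Real.exp_zero, mul_one, one_mul]
  set T := u.1 + u.2.1 + u.2.2
  calc T * Real.exp (-T ^ 2 / 2) ≤ Real.exp T * Real.exp (-T ^ 2 / 2) := by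
        gcongr
        linarith [Real.add_one_le_exp T]
    _ ≤ Real.exp 2 * Real.exp (-T) := by
        rw [← Real.exp_add, ← Real.exp_add]
        refine Real.exp_le_exp.2 ?_
        nlinarith [sq_nonneg (T - 2)]

lemma iseTransform_nonneg (r : ℝ) : 0 ≤ iseTransform a b e r :=
  setIntegral_nonneg measurableSet_octant fun _ hu => iseKernel_nonneg a b e r hu

lemma iseTransform_le_zero (ha : 0 ≤ a) (hb : 0 ≤ b) (he : 0 ≤ e) {r : ℝ} (hr : 0 ≤ r) :
    iseTransform a b e r ≤ iseTransform a b e 0 :=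
  setIntegral_mono_on (integrableOn_iseKernel ha hb he hr) (integrableOn_iseKernel ha hb he le_rfl)
    measurableSet_octant fun _ hu => iseKernel_le_zero ha hb he hr hu

lemma continuous_iseTransform_sqrt (ha : 0 ≤ a) (hb : 0 ≤ b) (he : 0 ≤ e) :
    Continuous fun y : ℝ => iseTransform a b e √y := by
  refine continuous_of_dominated (bound := iseKernel a b e 0)
    (fun y => (continuous_iseKernel a b e √y).aestronglyMeasurable) (fun y => ?_)
    (integrableOn_iseKernel ha hb he le_rfl) (Eventually.of_forall fun u => ?_)
  · filter_upwards [ae_restrict_mem measurableSet_octant] with u hu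
    rw [Real.norm_of_nonneg (iseKernel_nonneg a b e _ hu)]
    exact iseKernel_le_zero ha hb he (Real.sqrt_nonneg y) hu
  · unfold iseKernel
    fun_prop

lemma iseTransform_eq_iterated (ha : 0 ≤ a) (hb : 0 ≤ b) (he : 0 ≤ e) {r : ℝ} (hr : 0 ≤ r) :
    iseTransform a b e r = ∫ t₁ in Ioi (0 : ℝ), ∫ t₂ in Ioi (0 : ℝ), ∫ t₃ in Ioi (0 : ℝ),
      iseKernel a b e r (t₁, t₂, t₃) := by
  have h := integrableOn_iseKernel ha hb he hr
  rw [IntegrableOn, volume_restrict_octant] at h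
  rw [iseTransform, volume_restrict_octant, integral_prod _ h]
  refine integral_congr_ae ?_
  filter_upwards [h.prod_right_ae] with t ht
  exact integral_prod _ ht

lemma iseTransform_mul (a b e s r : ℝ) :
    iseTransform (s * a) (s * b) (s * e) r = iseTransform a b e (s * r) := by
  unfold iseTransform iseKernel
  congr! 6
  ring

lemma setIntegral_levyDensity (a b e : ℝ) {τ : ℝ} (hτ : 0 < τ) :
    ∫ u in octant, levyDensity (2 * √2 * (u.1 + u.2.1 + u.2.2)) τ *
        Real.exp (-(a * u.1 + b * u.2.1 + e * u.2.2)) =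
      √2 / (16 * √Real.pi) * (√τ * iseTransform a b e √τ) := by
  have hr : 0 < √τ := Real.sqrt_pos.2 hτ
  have hsq : √τ ^ 2 = τ := Real.sq_sqrt hτ.le
  have hpi : 0 < √Real.pi := Real.sqrt_pos.2 Real.pi_pos
  have h := setIntegral_octant_comp_smul (iseKernel a b e √τ) (R := 2 / √τ) (by positivity)
  have hk : ∀ u : ℝ × ℝ × ℝ, levyDensity (2 * √2 * (u.1 + u.2.1 + u.2.2)) τ *
      Real.exp (-(a * u.1 + b * u.2.1 + e * u.2.2)) =
      √2 / (2 * √Real.pi * √τ ^ 2) * iseKernel a b e √τ ((2 / √τ) • u) := by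
    intro u
    simp only [iseKernel, levyDensity, Prod.smul_fst, Prod.smul_snd, smul_eq_mul]
    have e1 : -(2 / √τ * u.1 + 2 / √τ * u.2.1 + 2 / √τ * u.2.2) ^ 2 / 2 =
        -(2 * √2 * (u.1 + u.2.1 + u.2.2)) ^ 2 / (4 * τ) := by
      rw [mul_pow (2 * √2), mul_pow 2, Real.sq_sqrt zero_le_two,
        show 4 * τ = 4 * √τ ^ 2 by rw [hsq]]
      field_simp
      ring
    have e2 : -(√τ * (a * (2 / √τ * u.1) + b * (2 / √τ * u.2.1) + e * (2 / √τ * u.2.2))) / 2 =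
        -(a * u.1 + b * u.2.1 + e * u.2.2) := by
      field_simp
    rw [e1, e2]
    have : τ * √τ = √τ ^ 3 := by rw [pow_succ, hsq]
    rw [this]
    field_simp
  simp_rw [hk]
  rw [integral_const_mul, h, iseTransform]
  field_simp
  ring

lemma laplace_iseTransform (ha : 0 ≤ a) (hb : 0 ≤ b) (he : 0 ≤ e) {s : ℝ} (hs : 0 < s) :
    IntegrableOn (fun τ => Real.exp (-(s ^ 2 * τ)) *
        (√2 / (16 * √Real.pi) * (√τ * iseTransform a b e √τ))) (Ioi 0) ∧
      ∫ τ in Ioi 0, Real.exp (-(s ^ 2 * τ)) *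
          (√2 / (16 * √Real.pi) * (√τ * iseTransform a b e √τ)) =
        ((a + 2 * √2 * s) * (b + 2 * √2 * s) * (e + 2 * √2 * s))⁻¹ := by
  have h2 : 0 < √(2 : ℝ) := Real.sqrt_pos.2 two_pos
  let F : ℝ → ℝ × ℝ × ℝ → ℝ := fun τ u =>
    levyDensity (2 * √2 * (u.1 + u.2.1 + u.2.2)) τ * Real.exp (-(s ^ 2 * τ)) *
      Real.exp (-(a * u.1 + b * u.2.1 + e * u.2.2))
  have hlap : ∀ u ∈ octant, IntegrableOn (fun τ => F τ u) (Ioi 0) ∧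
      ∫ τ in Ioi 0, F τ u = Real.exp (-((a + 2 * √2 * s) * u.1 + (b + 2 * √2 * s) * u.2.1 +
        (e + 2 * √2 * s) * u.2.2)) := by
    intro u hu
    obtain ⟨h1, h2, h3⟩ := mem_octant.1 hu
    obtain ⟨hi, hv⟩ := laplace_levyDensity (x := 2 * √2 * (u.1 + u.2.1 + u.2.2)) (by positivity) hs
    refine ⟨hi.mul_const _, ?_⟩
    rw [integral_mul_const, hv, ← Real.exp_add]
    congr 1
    ring
  have hmeas : Measurable (Function.uncurry F) := by
    simp only [F, levyDensity, Function.uncurry_def]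
    fun_prop
  have hint : Integrable (Function.uncurry F)
      ((volume.restrict (Ioi 0)).prod (volume.restrict octant)) := by
    rw [integrable_prod_iff' hmeas.aestronglyMeasurable]
    constructor
    · filter_upwards [ae_restrict_mem measurableSet_octant] with u hu
      exact (hlap u hu).1
    · refine (integrableOn_exp_neg_octant (p := a + 2 * √2 * s) (q := b + 2 * √2 * s)
        (r := e + 2 * √2 * s) (by positivity) (by positivity) (by positivity)).congr ?_
      filter_upwards [ae_restrict_mem measurableSet_octant] with u hu
      rw [← (hlap u hu).2]
      refine setIntegral_congr_fun measurableSet_Ioi fun τ hτ => ?_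
      obtain ⟨h1, h2, h3⟩ := mem_octant.1 hu
      have := levyDensity_nonneg (x := 2 * √2 * (u.1 + u.2.1 + u.2.2)) (by positivity) (le_of_lt hτ)
      refine (Real.norm_of_nonneg ?_).symm
      simp only [F]
      positivity
  have hF : ∀ τ ∈ Ioi (0 : ℝ), ∫ u in octant, F τ u = Real.exp (-(s ^ 2 * τ)) *
      (√2 / (16 * √Real.pi) * (√τ * iseTransform a b e √τ)) := by
    intro τ hτ
    rw [← setIntegral_levyDensity a b e hτ, ← integral_const_mul]
    simp only [F]
    congr! 2
    ring
  constructor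
  · refine hint.integral_prod_left.congr ?_
    filter_upwards [ae_restrict_mem measurableSet_Ioi] with τ hτ
    exact hF τ hτ
  · rw [← setIntegral_congr_fun measurableSet_Ioi hF, integral_integral_swap hint,
      setIntegral_congr_fun measurableSet_octant fun u hu => (hlap u hu).2,
      setIntegral_exp_neg_octant (by positivity) (by positivity) (by positivity)]

end Kernel

section GammaMean

lemma integrableOn_exp_neg_mul_pow (m : ℕ) :
    IntegrableOn (fun τ : ℝ => Real.exp (-τ) * τ ^ m) (Ioi 0) := by
  have h := Real.GammaIntegral_convergent (s := m + 1) (by positivity)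
  simpa using! h

lemma integral_exp_neg_mul_pow (m : ℕ) :
    ∫ τ in Ioi (0 : ℝ), Real.exp (-τ) * τ ^ m = m.factorial := by
  have h := Real.Gamma_eq_integral (s := m + 1) (by positivity)
  rw [Real.Gamma_nat_eq_factorial] at h
  simpa using h.symm

/-- The density of the Gamma distribution with parameter `n + 1`. -/
def gammaWeight (n : ℕ) (τ : ℝ) : ℝ := Real.exp (-τ) * τ ^ n / n.factorial

lemma gammaWeight_nonneg (n : ℕ) {τ : ℝ} (hτ : 0 ≤ τ) : 0 ≤ gammaWeight n τ := by
  unfold gammaWeight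
  positivity

lemma continuous_gammaWeight (n : ℕ) : Continuous (gammaWeight n) := by
  unfold gammaWeight
  fun_prop

lemma gammaWeight_mul_pow (n m : ℕ) (τ : ℝ) :
    gammaWeight n τ * τ ^ m = Real.exp (-τ) * τ ^ (n + m) * (n.factorial : ℝ)⁻¹ := by
  rw [gammaWeight, pow_add]
  ring

lemma integrableOn_gammaWeight_mul_pow (n m : ℕ) :
    IntegrableOn (fun τ => gammaWeight n τ * τ ^ m) (Ioi 0) := by
  simp_rw [gammaWeight_mul_pow]
  exact (integrableOn_exp_neg_mul_pow _).mul_const _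

lemma integral_gammaWeight_mul_pow (n m : ℕ) :
    ∫ τ in Ioi (0 : ℝ), gammaWeight n τ * τ ^ m = (n + m).factorial / n.factorial := by
  simp_rw [gammaWeight_mul_pow]
  rw [integral_mul_const, integral_exp_neg_mul_pow, div_eq_mul_inv]

lemma integrableOn_gammaWeight (n : ℕ) : IntegrableOn (gammaWeight n) (Ioi 0) := by
  simpa using integrableOn_gammaWeight_mul_pow n 0

lemma integral_gammaWeight (n : ℕ) : ∫ τ in Ioi (0 : ℝ), gammaWeight n τ = 1 := by
  have h := integral_gammaWeight_mul_pow n 0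
  have : (n.factorial : ℝ) ≠ 0 := by positivity
  simpa [this] using h

lemma gammaWeight_mul_sq_eq {n : ℕ} (hn : n ≠ 0) (τ : ℝ) :
    gammaWeight n τ * (τ / n - 1) ^ 2 = gammaWeight n τ * τ ^ 2 * ((n : ℝ) ^ 2)⁻¹ -
      gammaWeight n τ * τ ^ 1 * (2 / n) + gammaWeight n τ := by
  have : (n : ℝ) ≠ 0 := by exact_mod_cast hn
  field_simp
  ring

lemma integrableOn_gammaWeight_mul_sq {n : ℕ} (hn : n ≠ 0) :
    IntegrableOn (fun τ => gammaWeight n τ * (τ / n - 1) ^ 2) (Ioi 0) := by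
  simp_rw [gammaWeight_mul_sq_eq hn]
  exact (((integrableOn_gammaWeight_mul_pow n 2).mul_const _).sub
    ((integrableOn_gammaWeight_mul_pow n 1).mul_const _)).add (integrableOn_gammaWeight n)

/-- The second moment of `τ / n - 1` under the Gamma distribution with parameter `n + 1`. -/
lemma integral_gammaWeight_mul_sq {n : ℕ} (hn : n ≠ 0) :
    ∫ τ in Ioi (0 : ℝ), gammaWeight n τ * (τ / n - 1) ^ 2 = (n + 2) / (n : ℝ) ^ 2 := by
  have h0 : (n : ℝ) ≠ 0 := by exact_mod_cast hn
  have h1 : (n.factorial : ℝ) ≠ 0 := by positivity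
  have i2 : IntegrableOn (fun τ => gammaWeight n τ * τ ^ 2 * ((n : ℝ) ^ 2)⁻¹) (Ioi 0) :=
    (integrableOn_gammaWeight_mul_pow n 2).mul_const _
  have i1 : IntegrableOn (fun τ => gammaWeight n τ * τ ^ 1 * (2 / (n : ℝ))) (Ioi 0) :=
    (integrableOn_gammaWeight_mul_pow n 1).mul_const _
  have i21 : IntegrableOn (fun τ => gammaWeight n τ * τ ^ 2 * ((n : ℝ) ^ 2)⁻¹ -
      gammaWeight n τ * τ ^ 1 * (2 / (n : ℝ))) (Ioi 0) := i2.sub i1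
  simp_rw [gammaWeight_mul_sq_eq hn]
  rw [integral_add i21 (integrableOn_gammaWeight n), integral_sub i2 i1,
    integral_mul_const, integral_mul_const, integral_gammaWeight_mul_pow,
    integral_gammaWeight_mul_pow, integral_gammaWeight]
  simp only [Nat.factorial_succ, Nat.cast_mul, Nat.cast_add, Nat.cast_one]
  field_simp
  ring

lemma exists_abs_sub_le_add_sq {h : ℝ → ℝ} (hc : ContinuousAt h 1) {M : ℝ}
    (hM : ∀ y, 0 ≤ y → |h y| ≤ M * (1 + y)) {ε : ℝ} (hε : 0 < ε) :
    ∃ C, 0 ≤ C ∧ ∀ y, 0 ≤ y → |h y - h 1| ≤ ε + C * (y - 1) ^ 2 := by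
  obtain ⟨δ, hδ, hd⟩ := Metric.continuousAt_iff.1 hc ε hε
  have hM0 : 0 ≤ M := by
    have := (abs_nonneg _).trans (hM 0 le_rfl)
    linarith
  refine ⟨M / δ + 4 * M / δ ^ 2, by positivity, fun y hy => ?_⟩
  by_cases hyδ : |y - 1| < δ
  · have := hd (x := y) (by rwa [Real.dist_eq])
    rw [Real.dist_eq] at this
    have : 0 ≤ (M / δ + 4 * M / δ ^ 2) * (y - 1) ^ 2 := by positivity
    linarith
  · have hge : 1 ≤ |y - 1| / δ := by
      rw [le_div_iff₀ hδ]
      linarith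
    have h1 : |h y - h 1| ≤ M * |y - 1| + 4 * M := by
      have e1 := hM y hy
      have e2 := hM 1 zero_le_one
      have e3 := abs_sub (h y) (h 1)
      have e4 : M * (y - 1) ≤ M * |y - 1| := by gcongr; exact le_abs_self _
      linarith
    have h2 : (y - 1) ^ 2 = |y - 1| ^ 2 := (sq_abs _).symm
    have h3 : (M / δ + 4 * M / δ ^ 2) * (y - 1) ^ 2 =
        M * |y - 1| * (|y - 1| / δ) + 4 * M * (|y - 1| / δ) ^ 2 := by
      rw [h2]
      field_simp
    rw [h3]
    have h4 : M * |y - 1| * 1 ≤ M * |y - 1| * (|y - 1| / δ) := by gcongr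
    have h5 : 4 * M * 1 ^ 2 ≤ 4 * M * (|y - 1| / δ) ^ 2 := by gcongr
    linarith

lemma integrableOn_gammaWeight_mul_comp {h : ℝ → ℝ} (hc : Continuous h) {M : ℝ}
    (hM : ∀ y, 0 ≤ y → |h y| ≤ M * (1 + y)) (n : ℕ) :
    IntegrableOn (fun τ => gammaWeight n τ * h (τ / n)) (Ioi 0) := by
  have hb := ((integrableOn_gammaWeight n).add
    ((integrableOn_gammaWeight_mul_pow n 1).mul_const (n : ℝ)⁻¹)).const_mul M
  refine Integrable.mono' hb
    ((continuous_gammaWeight n).mul (by fun_prop)).aestronglyMeasurable ?_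
  filter_upwards [ae_restrict_mem measurableSet_Ioi] with τ hτ
  have hτ0 : (0 : ℝ) ≤ τ := le_of_lt hτ
  rw [norm_mul, Real.norm_of_nonneg (gammaWeight_nonneg n hτ0), Real.norm_eq_abs]
  calc gammaWeight n τ * |h (τ / n)| ≤ gammaWeight n τ * (M * (1 + τ / n)) :=
        mul_le_mul_of_nonneg_left (hM _ (by positivity)) (gammaWeight_nonneg n hτ0)
    _ = _ := by
        simp only [Pi.add_apply]
        ring

/-- Law of large numbers for the Gamma distribution with parameter `n + 1`, scaled by `n`. -/
lemma tendsto_integral_gammaWeight {h : ℝ → ℝ} (hc : Continuous h) {M : ℝ}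
    (hM : ∀ y, 0 ≤ y → |h y| ≤ M * (1 + y)) :
    Tendsto (fun n : ℕ => ∫ τ in Ioi (0 : ℝ), gammaWeight n τ * h (τ / n)) atTop (𝓝 (h 1)) := by
  rw [Metric.tendsto_nhds]
  intro ε hε
  obtain ⟨C, hC, hbd⟩ := exists_abs_sub_le_add_sq hc.continuousAt hM (half_pos hε)
  have hlim : Tendsto (fun n : ℕ => C * ((n : ℝ)⁻¹ + 2 * (n : ℝ)⁻¹ ^ 2)) atTop (𝓝 0) := by
    have h1 := tendsto_inv_atTop_nhds_zero_nat (𝕜 := ℝ)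
    simpa using (h1.add ((h1.pow 2).const_mul 2)).const_mul C
  filter_upwards [hlim.eventually (gt_mem_nhds (half_pos hε)), eventually_ne_atTop 0]
    with n hlt hn
  have hn0 : (n : ℝ) ≠ 0 := by exact_mod_cast hn
  have hsub : (∫ τ in Ioi (0 : ℝ), gammaWeight n τ * h (τ / n)) - h 1 =
      ∫ τ in Ioi (0 : ℝ), gammaWeight n τ * (h (τ / n) - h 1) := by
    simp_rw [mul_sub]
    rw [integral_sub (integrableOn_gammaWeight_mul_comp hc hM n)
      ((integrableOn_gammaWeight n).mul_const _), integral_mul_const, integral_gammaWeight, one_mul]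
  have hi := ((integrableOn_gammaWeight n).const_mul (ε / 2)).add
    ((integrableOn_gammaWeight_mul_sq hn).const_mul C)
  rw [Real.dist_eq, hsub]
  calc |∫ τ in Ioi (0 : ℝ), gammaWeight n τ * (h (τ / n) - h 1)|
      ≤ ∫ τ in Ioi (0 : ℝ), (ε / 2 * gammaWeight n τ +
          C * (gammaWeight n τ * (τ / n - 1) ^ 2)) := by
        rw [← Real.norm_eq_abs]
        refine norm_integral_le_of_norm_le hi ?_
        filter_upwards [ae_restrict_mem measurableSet_Ioi] with τ hτ
        have hτ0 : (0 : ℝ) ≤ τ := le_of_lt hτ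
        rw [norm_mul, Real.norm_of_nonneg (gammaWeight_nonneg n hτ0), Real.norm_eq_abs]
        have := mul_le_mul_of_nonneg_left (hbd (τ / n) (by positivity)) (gammaWeight_nonneg n hτ0)
        linarith
    _ = ε / 2 + C * ((n + 2) / (n : ℝ) ^ 2) := by
        rw [integral_add ((integrableOn_gammaWeight n).const_mul (ε / 2))
          ((integrableOn_gammaWeight_mul_sq hn).const_mul C), integral_const_mul,
          integral_const_mul, integral_gammaWeight, integral_gammaWeight_mul_sq hn, mul_one]
    _ = ε / 2 + C * ((n : ℝ)⁻¹ + 2 * (n : ℝ)⁻¹ ^ 2) := by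
        field_simp
    _ < ε := by linarith

end GammaMean

section Taylor

open ProbabilityTheory

/-- If `f` agrees near `0` with the Laplace transform of `ρ` evaluated at `1 - z`, then its Taylor
coefficients at `0` are Gamma averages of `ρ`. -/
lemma taylorCoeff_eq_of_laplace {f : ℂ → ℂ} {ρ : ℝ → ℝ} (hf : AnalyticAt ℂ f 0)
    (hρm : Measurable ρ) (hρ0 : ∀ τ, 0 < τ → 0 ≤ ρ τ)
    (hρi : ∀ x < (1 : ℝ), IntegrableOn (fun τ => Real.exp (-((1 - x) * τ)) * ρ τ) (Ioi 0))
    (hfρ : ∀ x < (1 : ℝ), f x = ((∫ τ in Ioi 0, Real.exp (-((1 - x) * τ)) * ρ τ : ℝ) : ℂ))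
    (n : ℕ) :
    taylorCoeff f n = ((∫ τ in Ioi 0, gammaWeight n τ * ρ τ : ℝ) : ℂ) := by
  set d : ℝ → ENNReal := fun τ => ENNReal.ofReal (Real.exp (-τ) * ρ τ) with hd
  have hdm : Measurable d := by fun_prop
  have hdlt : ∀ᵐ τ ∂(volume.restrict (Ioi (0 : ℝ))), d τ < ⊤ :=
    Eventually.of_forall fun τ => ENNReal.ofReal_lt_top
  have hdr : ∀ τ ∈ Ioi (0 : ℝ), (d τ).toReal = Real.exp (-τ) * ρ τ := fun τ hτ =>
    ENNReal.toReal_ofReal (mul_nonneg (Real.exp_pos _).le (hρ0 τ hτ))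
  set μ : Measure ℝ := (volume.restrict (Ioi (0 : ℝ))).withDensity d with hμ
  have hexp : ∀ x τ : ℝ, Real.exp (-τ) * ρ τ * Real.exp (x * τ) =
      Real.exp (-((1 - x) * τ)) * ρ τ := fun x τ => by
    rw [mul_right_comm, ← Real.exp_add]
    congr 2
    ring
  have hset : Iio 1 ⊆ integrableExpSet id μ := by
    intro x hx
    change Integrable (fun τ : ℝ => Real.exp (x * id τ)) μ
    rw [hμ, integrable_withDensity_iff_integrable_smul' hdm hdlt]
    refine (hρi x hx).congr ?_
    filter_upwards [ae_restrict_mem measurableSet_Ioi] with τ hτ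
    rw [hdr τ hτ, smul_eq_mul, id, hexp]
  have hint : (0 : ℂ).re ∈ interior (integrableExpSet id μ) :=
    interior_maximal hset isOpen_Iio (by simp)
  have hmgf : ∀ x < (1 : ℝ), complexMGF id μ x = f x := by
    intro x hx
    rw [complexMGF_ofReal, mgf, hfρ x hx, hμ,
      integral_withDensity_eq_integral_toReal_smul hdm hdlt]
    congr 1
    refine setIntegral_congr_fun measurableSet_Ioi fun τ hτ => ?_
    simp only [hdr τ hτ, smul_eq_mul, id, hexp]
  have hev : complexMGF id μ =ᶠ[𝓝 0] f := by
    refine ((analyticAt_complexMGF hint).frequently_eq_iff_eventually_eq hf).1 ?_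
    have hmap : Tendsto (fun x : ℝ => (x : ℂ)) (𝓝[≠] 0) (𝓝[≠] 0) := by
      refine tendsto_nhdsWithin_iff.2 ⟨?_, ?_⟩
      · have := Complex.continuous_ofReal.tendsto 0
        rw [Complex.ofReal_zero] at this
        exact this.mono_left nhdsWithin_le_nhds
      · filter_upwards [self_mem_nhdsWithin] with x hx
        simpa using hx
    refine hmap.frequently (Eventually.frequently ?_)
    filter_upwards [nhdsWithin_le_nhds (Iio_mem_nhds one_pos)] with x hx
    exact hmgf x hx
  rw [taylorCoeff, ← hev.iteratedDeriv_eq n, iteratedDeriv_complexMGF hint, hμ,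
    integral_withDensity_eq_integral_toReal_smul hdm hdlt, div_eq_mul_inv, ← integral_mul_const,
    ← integral_complex_ofReal]
  refine setIntegral_congr_fun measurableSet_Ioi fun τ hτ => ?_
  simp only [hdr τ hτ, id, gammaWeight]
  simp
  ring

lemma analyticAt_LambdaC {a : ℝ} (ha : 0 ≤ a) : AnalyticAt ℂ (LambdaC a) 0 := by
  unfold LambdaC
  have hs : AnalyticAt ℂ (fun z : ℂ => (1 - z) ^ ((1 : ℂ) / 2)) 0 :=
    (analyticAt_const.sub analyticAt_id).cpow analyticAt_const (by simp)
  refine analyticAt_const.div (analyticAt_const.add (analyticAt_const.mul hs)) ?_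
  simp only [sub_zero, Complex.one_cpow, mul_one]
  norm_cast
  positivity

lemma LambdaC_ofReal (a : ℝ) {x : ℝ} (hx : x < 1) :
    LambdaC a x = (((a + 2 * √2 * √(1 - x))⁻¹ : ℝ) : ℂ) := by
  have h : (1 - (x : ℂ)) ^ ((1 : ℂ) / 2) = ((√(1 - x) : ℝ) : ℂ) := by
    rw [Real.sqrt_eq_rpow, Complex.ofReal_cpow (by linarith)]
    simp
  rw [LambdaC, h]
  push_cast
  rw [one_div]

lemma taylorCoeff_LambdaC_mul {a b e : ℝ} (ha : 0 ≤ a) (hb : 0 ≤ b) (he : 0 ≤ e) (n : ℕ) :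
    taylorCoeff (fun z => LambdaC a z * LambdaC b z * LambdaC e z) n =
      ((∫ τ in Ioi 0, gammaWeight n τ *
        (√2 / (16 * √Real.pi) * (√τ * iseTransform a b e √τ)) : ℝ) : ℂ) := by
  have hlap : ∀ x < (1 : ℝ), _ := fun x hx =>
    laplace_iseTransform ha hb he (Real.sqrt_pos.2 (sub_pos.2 hx))
  have hsq : ∀ x < (1 : ℝ), √(1 - x) ^ 2 = 1 - x := fun x hx => Real.sq_sqrt (by linarith)
  refine taylorCoeff_eq_of_laplace (((analyticAt_LambdaC ha).mul (analyticAt_LambdaC hb)).mul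
    (analyticAt_LambdaC he)) ?_ (fun τ hτ => ?_) (fun x hx => ?_) (fun x hx => ?_) n
  · have := (continuous_iseTransform_sqrt ha hb he).measurable
    fun_prop
  · have := iseTransform_nonneg (a := a) (b := b) (e := e) √τ
    positivity
  · have := (hlap x hx).1
    rwa [hsq x hx] at this
  · have := (hlap x hx).2
    rw [hsq x hx] at this
    rw [this, Pi.mul_apply, Pi.mul_apply, LambdaC_ofReal a hx, LambdaC_ofReal b hx, LambdaC_ofReal e hx]
    push_cast
    rw [mul_inv, mul_inv]

end Taylor

lemma AhatThree_eq_iseTransform {d : ℕ} (k l : Fin d → ℝ) :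
    AhatThree k l =
      iseTransform (∑ i, (k i + l i) ^ 2) (∑ i, (k i) ^ 2) (∑ i, (l i) ^ 2) 1 := by
  rw [iseTransform_eq_iterated (by positivity) (by positivity) (by positivity) zero_le_one]
  simp only [AhatThree, iseKernel, one_mul]

/-- The rescaled Taylor coefficient is a Gamma average of a fixed function of `τ / n`. -/
lemma scaled_taylorCoeff_LambdaC_mul {a b e : ℝ} (ha : 0 ≤ a) (hb : 0 ≤ b) (he : 0 ≤ e) {n : ℕ}
    {s : ℝ} (hs : s = √(n : ℝ)⁻¹) :
    ((4 * √(8 * Real.pi) * s : ℝ) : ℂ) *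
        taylorCoeff (fun z => LambdaC (s * a) z * LambdaC (s * b) z * LambdaC (s * e) z) n =
      ((∫ τ in Ioi 0, gammaWeight n τ * (√(τ / n) * iseTransform a b e √(τ / n)) : ℝ) : ℂ) := by
  have hs0 : 0 ≤ s := hs ▸ Real.sqrt_nonneg _
  rw [taylorCoeff_LambdaC_mul (by positivity) (by positivity) (by positivity),
    ← Complex.ofReal_mul, ← integral_const_mul]
  congr 1
  refine setIntegral_congr_fun measurableSet_Ioi fun τ hτ => ?_
  have hsτ : s * √τ = √(τ / n) := by
    rw [hs, ← Real.sqrt_mul (by positivity), div_eq_inv_mul]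
  have h8 : √(8 * Real.pi) = 2 * √2 * √Real.pi := by
    rw [Real.sqrt_mul (by norm_num), show (8 : ℝ) = 2 ^ 2 * 2 by norm_num,
      Real.sqrt_mul (by norm_num), Real.sqrt_sq (by norm_num)]
  have hpi : 0 < √Real.pi := Real.sqrt_pos.2 Real.pi_pos
  have h2 : √(2 : ℝ) ^ 2 = 2 := Real.sq_sqrt zero_le_two
  simp only [iseTransform_mul, hsτ]
  rw [← hsτ, h8]
  field_simp
  rw [h2]
  ring

/-- If `p_n` is the `n`-th Taylor coefficient at `z = 0` of
`z ↦ Λ_z((k+l)n^{-1/4}) Λ_z(k n^{-1/4}) Λ_z(l n^{-1/4})`, then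
`4 √(8π) n^{-1/2} p_n → Â⁽³⁾(k,l)`. -/
theorem triple_lambda_coeff_limit :
    ∀ d : ℕ, ∀ k l : Fin d → ℝ,
      Filter.Tendsto
        (fun n : ℕ =>
          ((4 * Real.sqrt (8 * Real.pi) * (n : ℝ) ^ (-(1 : ℝ) / 2) : ℝ) : ℂ) *
            taylorCoeff
              (fun z : ℂ =>
                Lambda (fun i => (k i + l i) * (n : ℝ) ^ (-(1 : ℝ) / 4)) z *
                  Lambda (fun i => k i * (n : ℝ) ^ (-(1 : ℝ) / 4)) z *
                  Lambda (fun i => l i * (n : ℝ) ^ (-(1 : ℝ) / 4)) z) n)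
        Filter.atTop (nhds ((AhatThree k l : ℝ) : ℂ)) := by
  intro d k l
  set a := ∑ i, (k i + l i) ^ 2 with ha
  set b := ∑ i, (k i) ^ 2 with hb
  set e := ∑ i, (l i) ^ 2 with he
  have ha0 : 0 ≤ a := by positivity
  have hb0 : 0 ≤ b := by positivity
  have he0 : 0 ≤ e := by positivity
  let h : ℝ → ℝ := fun y => √y * iseTransform a b e √y
  have hc : Continuous h := Real.continuous_sqrt.mul (continuous_iseTransform_sqrt ha0 hb0 he0)
  have hM : ∀ y, 0 ≤ y → |h y| ≤ iseTransform a b e 0 * (1 + y) := by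
    intro y hy
    have h1 := iseTransform_nonneg (a := a) (b := b) (e := e) √y
    have h2 := iseTransform_le_zero ha0 hb0 he0 (Real.sqrt_nonneg y)
    have h3 : √y ≤ 1 + y := Real.sqrt_le_iff.2 ⟨by positivity, by nlinarith⟩
    change |√y * iseTransform a b e √y| ≤ _
    rw [abs_of_nonneg (by positivity), mul_comm]
    exact mul_le_mul h2 h3 (Real.sqrt_nonneg y) (h1.trans h2)
  have hlim := (Complex.continuous_ofReal.tendsto _).comp (tendsto_integral_gammaWeight hc hM)
  have h1 : h 1 = AhatThree k l := by
    simp [h, AhatThree_eq_iseTransform, ha, hb, he]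
  rw [h1] at hlim
  refine hlim.congr' ?_
  filter_upwards [eventually_ne_atTop 0] with n hn
  have hn0 : (0 : ℝ) < n := by exact_mod_cast Nat.pos_of_ne_zero hn
  have hs : (n : ℝ) ^ (-(1 : ℝ) / 2) = √(n : ℝ)⁻¹ := by
    rw [Real.sqrt_eq_rpow, Real.inv_rpow hn0.le, ← Real.rpow_neg hn0.le]
    norm_num
  have hq : ((n : ℝ) ^ (-(1 : ℝ) / 4)) ^ 2 = (n : ℝ) ^ (-(1 : ℝ) / 2) := by
    rw [← Real.rpow_natCast, ← Real.rpow_mul hn0.le]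
    norm_num
  have hL : ∀ m : Fin d → ℝ, Lambda (fun i => m i * (n : ℝ) ^ (-(1 : ℝ) / 4)) =
      LambdaC ((n : ℝ) ^ (-(1 : ℝ) / 2) * ∑ i, (m i) ^ 2) := by
    intro m
    funext z
    simp only [Lambda, mul_pow, hq, ← Finset.sum_mul]
    rw [mul_comm]
  rw [hL k, hL l, hL fun i => k i + l i, ← ha, ← hb, ← he,
    scaled_taylorCoeff_LambdaC_mul ha0 hb0 he0 hs]
  rfl
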